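/- For every t > 0 and every r > 0, the McKean kernel coincides with the Gruet kernel in dimension 2: (√2·e^{-t/8}/(2πt)^{3/2}) ∫_r^∞ b·e^{-b^2/(2t)}·(cosh(b) - cosh(r))^{-1/2} db = (e^{-t/8}/(π·2π·t^{1/2}))·Γ(3/2)·∫_0^∞ e^{(π^2 - b^2)/(2t)}·sinh(b)·sin(πb/t)/(cosh(b) + cosh(r))^{3/2} db. -/

import Mathlib

open Real MeasureTheory

/-- The Gruet kernel `p_n(t,r)` for the heat semigroup on hyperbolic space `ℍ^n`. -/
noncomputable def gruet (n : ℕ) (t r : ℝ) : ℝ :=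
  Real.exp (-((n : ℝ) - 1) ^ 2 * t / 8) / (π * (2 * π) ^ ((n : ℝ) / 2) * Real.sqrt t) *
    Real.Gamma (((n : ℝ) + 1) / 2) *
    ∫ b in Set.Ioi (0 : ℝ),
      Real.exp ((π ^ 2 - b ^ 2) / (2 * t)) * Real.sinh b * Real.sin (π * b / t) /
        (Real.cosh b + Real.cosh r) ^ (((n : ℝ) + 1) / 2)

/-- The McKean kernel for the hyperbolic plane `ℍ²`. -/
noncomputable def mckean (t r : ℝ) : ℝ :=
  Real.sqrt 2 * Real.exp (-t / 8) / (2 * π * t) ^ ((3 : ℝ) / 2) *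
    ∫ b in Set.Ioi r,
      b * Real.exp (-b ^ 2 / (2 * t)) * (Real.cosh b - Real.cosh r) ^ (-(1 : ℝ) / 2)

open Filter Topology

noncomputable def fK (t r : ℝ) (z : ℂ) : ℂ :=
  z * Complex.exp (-z ^ 2 / (2 * t)) *
    (Complex.I ^ (((1 / 2 : ℝ)) : ℂ) *
      (-Complex.I * (Complex.cosh z - (Real.cosh r : ℝ))) ^ (((-1 / 2 : ℝ)) : ℂ))

lemma cosh_re' (x y : ℝ) : (Complex.cosh (x + y * Complex.I)).re = Real.cosh x * Real.cos y := by
  rw [Complex.cosh_add, Complex.cosh_mul_I, Complex.sinh_mul_I]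
  simp [← Complex.ofReal_cosh, ← Complex.ofReal_sinh, ← Complex.ofReal_cos, ← Complex.ofReal_sin]

lemma cosh_im' (x y : ℝ) : (Complex.cosh (x + y * Complex.I)).im = Real.sinh x * Real.sin y := by
  rw [Complex.cosh_add, Complex.cosh_mul_I, Complex.sinh_mul_I]
  simp [← Complex.ofReal_cosh, ← Complex.ofReal_sinh, ← Complex.ofReal_cos, ← Complex.ofReal_sin]

lemma sinh_re' (x y : ℝ) : (Complex.sinh (x + y * Complex.I)).re = Real.sinh x * Real.cos y := by
  rw [Complex.sinh_add, Complex.cosh_mul_I, Complex.sinh_mul_I]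
  simp [← Complex.ofReal_cosh, ← Complex.ofReal_sinh, ← Complex.ofReal_cos, ← Complex.ofReal_sin]

lemma sinh_im' (x y : ℝ) : (Complex.sinh (x + y * Complex.I)).im = Real.cosh x * Real.sin y := by
  rw [Complex.sinh_add, Complex.cosh_mul_I, Complex.sinh_mul_I]
  simp [← Complex.ofReal_cosh, ← Complex.ofReal_sinh, ← Complex.ofReal_cos, ← Complex.ofReal_sin]

lemma slit (r x y : ℝ) (hr : 0 < r) (hx : 0 ≤ x) (hy : 0 ≤ y) (hy' : y ≤ π)
    (hne : ¬ (x = r ∧ y = 0)) :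
    -Complex.I * (Complex.cosh (x + y * Complex.I) - (Real.cosh r : ℝ)) ∈ Complex.slitPlane := by
  rw [Complex.mem_slitPlane_iff]
  have h1 : (-Complex.I * (Complex.cosh (x + y * Complex.I) - (Real.cosh r : ℝ))).re
      = Real.sinh x * Real.sin y := by
    rw [← cosh_im']; simp [-Complex.ofReal_cosh]
  have h2 : (-Complex.I * (Complex.cosh (x + y * Complex.I) - (Real.cosh r : ℝ))).im
      = -(Real.cosh x * Real.cos y - Real.cosh r) := by
    rw [← cosh_re']; simp [-Complex.ofReal_cosh]
  rw [h1, h2]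
  have hc : 1 < Real.cosh r := Real.one_lt_cosh.2 hr.ne'
  rcases hx.eq_or_lt with rfl | hx0
  · right
    have := Real.cos_le_one y
    simp; linarith
  rcases hy.eq_or_lt with rfl | hy0
  · right
    simp only [Real.cos_zero, mul_one]
    intro h
    apply hne
    refine ⟨?_, rfl⟩
    have h3 : Real.cosh x = Real.cosh r := by linarith
    have := Real.cosh_le_cosh.1 h3.le
    have h4 := Real.cosh_le_cosh.1 h3.ge
    rw [abs_of_pos hr, abs_of_pos hx0] at *
    linarith
  rcases hy'.eq_or_lt with rfl | hy1
  · right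
    have := Real.one_le_cosh x
    simp; linarith
  · left
    exact mul_pos (Real.sinh_pos_iff.2 hx0) (Real.sin_pos_of_pos_of_lt_pi hy0 hy1)

lemma norm_sinh_ge (x y : ℝ) : |x| ≤ ‖Complex.sinh (x + y * Complex.I)‖ := by
  have h : |x| ≤ |Real.sinh x| := by
    rw [Real.abs_sinh]; exact Real.self_le_sinh_iff.2 (abs_nonneg _)
  refine h.trans ?_
  apply abs_le_of_sq_le_sq _ (norm_nonneg _)
  · rw [← Complex.normSq_eq_norm_sq, Complex.normSq_apply, sinh_re', sinh_im']
    nlinarith [Real.sin_sq_add_cos_sq y, Real.cosh_sq x, sq_nonneg (Real.sin y), sq_nonneg (Real.sinh x)]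

lemma norm_lower (r x y : ℝ) (hr : 0 < r) (hx : 0 ≤ x) :
    |x - r| * (r / 2) ≤ ‖-Complex.I * (Complex.cosh (x + y * Complex.I) - (Real.cosh r : ℝ))‖ := by
  have h1 : Complex.cosh (x + y * Complex.I) - (Real.cosh r : ℝ) =
      2 * Complex.sinh (((x + r) / 2 : ℝ) + (y / 2 : ℝ) * Complex.I) *
        Complex.sinh (((x - r) / 2 : ℝ) + (y / 2 : ℝ) * Complex.I) := by
    have e1 : (x + y * Complex.I : ℂ) = (((x + r) / 2 : ℝ) + (y / 2 : ℝ) * Complex.I) +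
        (((x - r) / 2 : ℝ) + (y / 2 : ℝ) * Complex.I) := by push_cast; ring
    have e2 : ((Real.cosh r : ℝ) : ℂ) = Complex.cosh ((((x + r) / 2 : ℝ) + (y / 2 : ℝ) * Complex.I) -
        (((x - r) / 2 : ℝ) + (y / 2 : ℝ) * Complex.I)) := by
      rw [Complex.ofReal_cosh]; congr 1; push_cast; ring
    rw [e2, e1, Complex.cosh_add, Complex.cosh_sub]; ring
  rw [h1]
  simp only [norm_mul, norm_neg, Complex.norm_I, one_mul, Complex.norm_ofNat]
  have a := norm_sinh_ge ((x + r) / 2) (y / 2)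
  have b := norm_sinh_ge ((x - r) / 2) (y / 2)
  have c : r / 2 ≤ |(x + r) / 2| := by rw [abs_of_nonneg (by positivity)]; linarith
  have d : |(x - r) / 2| = |x - r| / 2 := by rw [abs_div]; simp
  rw [d] at b
  have := mul_le_mul (c.trans a) b (by positivity) (norm_nonneg _)
  linarith

lemma fK_bound (t r x y : ℝ) (ht : 0 < t) (hr : 0 < r) (hx : 0 ≤ x) (hxr : x ≠ r) (hy : 0 ≤ y)
    (hy' : y ≤ π) : ‖fK t r (x + y * Complex.I)‖ ≤
      (x + π) * (Real.exp (π ^ 2 / (2 * t)) * Real.exp (-(1 / (2 * t)) * x ^ 2)) *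
        (|x - r| * (r / 2)) ^ (-1 / 2 : ℝ) := by
  unfold fK
  rw [norm_mul, norm_mul, norm_mul, Complex.norm_cpow_real, Complex.norm_cpow_real, Complex.norm_I,
    Real.one_rpow, one_mul]
  have hp : 0 < |x - r| * (r / 2) := mul_pos (abs_pos.2 (sub_ne_zero.2 hxr)) (by positivity)
  have h1 : ‖(x + y * Complex.I : ℂ)‖ ≤ x + π := by
    refine (norm_add_le _ _).trans ?_
    simp only [Complex.norm_real, norm_mul, Complex.norm_I, mul_one, Real.norm_eq_abs,
      abs_of_nonneg hx, abs_of_nonneg hy]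
    linarith
  have h2 : ‖Complex.exp (-(x + y * Complex.I : ℂ) ^ 2 / (2 * t))‖ ≤
      Real.exp (π ^ 2 / (2 * t)) * Real.exp (-(1 / (2 * t)) * x ^ 2) := by
    rw [Complex.norm_exp, ← Real.exp_add]
    apply Real.exp_le_exp.2
    have : (-(x + y * Complex.I : ℂ) ^ 2 / (2 * t)) =
        (((y ^ 2 - x ^ 2) / (2 * t) : ℝ) : ℂ) + ((-(2 * x * y) / (2 * t) : ℝ) : ℂ) * Complex.I := by
      push_cast
      have : (t : ℂ) ≠ 0 := by exact_mod_cast ht.ne'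
      field_simp
      ring_nf
      simp only [Complex.I_sq]
      ring
    rw [this]
    simp only [Complex.add_re, Complex.ofReal_re, Complex.mul_re, Complex.I_re, Complex.I_im,
      Complex.ofReal_im, mul_zero, zero_mul, sub_zero, add_zero]
    have : y ^ 2 ≤ π ^ 2 := by gcongr
    have h3 : (y ^ 2 - x ^ 2) / (2 * t) ≤ (π ^ 2 - x ^ 2) / (2 * t) := by gcongr
    refine h3.trans (le_of_eq ?_)
    field_simp
    ring
  have h3 := Real.rpow_le_rpow_of_nonpos hp (norm_lower r x y hr hx) (by norm_num : (-1 / 2 : ℝ) ≤ 0)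
  have hpi := Real.pi_pos
  gcongr

lemma fK_diff (t r x y : ℝ) (hr : 0 < r) (hx : 0 ≤ x) (hy : 0 ≤ y) (hy' : y ≤ π)
    (hne : ¬ (x = r ∧ y = 0)) : DifferentiableAt ℂ (fK t r) (x + y * Complex.I) := by
  have h := slit r x y hr hx hy hy' hne
  unfold fK
  have h2 : DifferentiableAt ℂ (fun z : ℂ => (-Complex.I * (Complex.cosh z - (Real.cosh r : ℝ)))) (x + y * Complex.I) := by
    fun_prop
  have h3 : DifferentiableAt ℂ (fun z : ℂ => (-Complex.I * (Complex.cosh z - (Real.cosh r : ℝ))) ^ (((-1 / 2 : ℝ)) : ℂ)) (x + y * Complex.I) :=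
    h2.cpow_const h
  fun_prop

lemma fK_meas (t r : ℝ) : Measurable (fK t r) := by
  unfold fK
  fun_prop

lemma I_half_sq : Complex.I ^ (((1 / 2 : ℝ)) : ℂ) * Complex.I ^ (((1 / 2 : ℝ)) : ℂ) = Complex.I := by
  rw [← Complex.cpow_add _ _ Complex.I_ne_zero]
  push_cast
  norm_num

lemma g_pos (s : ℝ) (hs : 0 ≤ s) : Complex.I ^ (((1 / 2 : ℝ)) : ℂ) *
    (-Complex.I * (s : ℂ)) ^ (((-1 / 2 : ℝ)) : ℂ) = Complex.I * ((s ^ (-1 / 2 : ℝ) : ℝ) : ℂ) := by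
  rcases hs.eq_or_lt with rfl | hs
  · simp only [Complex.ofReal_zero, mul_zero]
    rw [Complex.zero_cpow (by simp), Real.zero_rpow (by norm_num)]
    simp
  rw [mul_comm (-Complex.I), Complex.ofReal_cpow hs.le]
  have h : ((s : ℂ) * -Complex.I) ^ (((-1 / 2 : ℝ)) : ℂ) = (s : ℂ) ^ (((-1 / 2 : ℝ)) : ℂ) * (-Complex.I) ^ (((-1 / 2 : ℝ)) : ℂ) := by
    rw [Complex.cpow_def_of_ne_zero (by simp [hs.ne']), Complex.log_ofReal_mul hs (by simp), add_mul, Complex.exp_add,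
      Complex.cpow_def_of_ne_zero (x := (s : ℂ)) (by simp [hs.ne']), Complex.cpow_def_of_ne_zero (by simp), Complex.ofReal_log hs.le]
  have h2 : (-Complex.I) ^ (((-1 / 2 : ℝ)) : ℂ) = Complex.I ^ (((1 / 2 : ℝ)) : ℂ) := by
    rw [Complex.cpow_def_of_ne_zero (by simp), Complex.cpow_def_of_ne_zero (by simp), Complex.log_neg_I, Complex.log_I]
    congr 1; push_cast; ring
  rw [h, h2]
  linear_combination (s : ℂ) ^ (((-1 / 2 : ℝ)) : ℂ) * I_half_sq

lemma g_neg (s : ℝ) (hs : 0 ≤ s) : Complex.I ^ (((1 / 2 : ℝ)) : ℂ) *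
    (-Complex.I * ((-s : ℝ) : ℂ)) ^ (((-1 / 2 : ℝ)) : ℂ) = ((s ^ (-1 / 2 : ℝ) : ℝ) : ℂ) := by
  rcases hs.eq_or_lt with rfl | hs
  · simp only [Complex.ofReal_zero, mul_zero, neg_zero]
    rw [Complex.zero_cpow (by simp), Real.zero_rpow (by norm_num)]
    simp
  rw [show (-Complex.I * ((-s : ℝ) : ℂ)) = (s : ℂ) * Complex.I by push_cast; ring, Complex.ofReal_cpow hs.le]
  have h : ((s : ℂ) * Complex.I) ^ (((-1 / 2 : ℝ)) : ℂ) = (s : ℂ) ^ (((-1 / 2 : ℝ)) : ℂ) * (Complex.I) ^ (((-1 / 2 : ℝ)) : ℂ) := by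
    rw [Complex.cpow_def_of_ne_zero (by simp [hs.ne']), Complex.log_ofReal_mul hs (by simp), add_mul, Complex.exp_add,
      Complex.cpow_def_of_ne_zero (x := (s : ℂ)) (by simp [hs.ne']), Complex.cpow_def_of_ne_zero (by simp), Complex.ofReal_log hs.le]
  rw [h, mul_left_comm, ← Complex.cpow_add _ _ Complex.I_ne_zero]
  push_cast
  norm_num

noncomputable def mI (t r b : ℝ) : ℝ :=
  b * Real.exp (-b ^ 2 / (2 * t)) * (Real.cosh b - Real.cosh r) ^ (-(1 : ℝ) / 2)

noncomputable def qI (t r b : ℝ) : ℝ :=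
  Real.exp ((π ^ 2 - b ^ 2) / (2 * t)) * (π * Real.cos (π * b / t) - b * Real.sin (π * b / t)) *
    (Real.cosh b + Real.cosh r) ^ (-(1 : ℝ) / 2)

lemma fK_bottom_gt (t r x : ℝ) (h : Real.cosh r ≤ Real.cosh x) :
    fK t r x = Complex.I * (mI t r x : ℝ) := by
  unfold fK mI
  rw [← Complex.ofReal_cosh, ← Complex.ofReal_sub, g_pos _ (by linarith)]
  push_cast
  ring

lemma fK_bottom_lt (t r x : ℝ) (h : Real.cosh x ≤ Real.cosh r) :
    fK t r x = ((x * Real.exp (-x ^ 2 / (2 * t)) * (Real.cosh r - Real.cosh x) ^ (-1 / 2 : ℝ) : ℝ) : ℂ) := by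
  unfold fK
  rw [← Complex.ofReal_cosh, ← Complex.ofReal_sub, ← neg_sub (Real.cosh r), g_neg _ (by linarith)]
  push_cast
  ring

lemma fK_left (t r y : ℝ) :
    fK t r (y * Complex.I) = Complex.I * ((y * Real.exp (y ^ 2 / (2 * t)) * (Real.cosh r - Real.cos y) ^ (-1 / 2 : ℝ) : ℝ) : ℂ) := by
  unfold fK
  have := Real.cos_le_one y
  have := Real.one_le_cosh r
  rw [Complex.cosh_mul_I, ← Complex.ofReal_cos, ← Complex.ofReal_sub, ← neg_sub (Real.cosh r), g_neg _ (by linarith)]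
  rw [show -(y * Complex.I) ^ 2 = ((y ^ 2 : ℝ) : ℂ) by rw [mul_pow, Complex.I_sq]; push_cast; ring]
  push_cast
  ring

lemma fK_top (t r x : ℝ) (ht : 0 < t) :
    (fK t r (x + (π : ℝ) * Complex.I)).im = qI t r x := by
  unfold fK qI
  have := Real.cosh_pos x
  have := Real.cosh_pos r
  have h1 : Complex.cosh (x + (π : ℝ) * Complex.I) - (Real.cosh r : ℝ) = ((-(Real.cosh x + Real.cosh r) : ℝ) : ℂ) := by
    rw [Complex.cosh_add, Complex.cosh_mul_I, Complex.sinh_mul_I]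
    simp
    ring
  have h2 : (-(x + (π : ℝ) * Complex.I : ℂ) ^ 2 / (2 * t)) =
        (((π ^ 2 - x ^ 2) / (2 * t) : ℝ) : ℂ) + ((-(π * x / t) : ℝ) : ℂ) * Complex.I := by
      push_cast
      have : (t : ℂ) ≠ 0 := by exact_mod_cast ht.ne'
      field_simp
      ring_nf
      simp only [Complex.I_sq]
      ring
  rw [h1, g_neg _ (by positivity), h2, Complex.exp_add, Complex.exp_mul_I, Complex.im_mul_ofReal, ← Complex.ofReal_exp,
    ← Complex.ofReal_cos, ← Complex.ofReal_sin]
  simp [-Complex.ofReal_exp, -Complex.ofReal_cos, -Complex.ofReal_sin, -Complex.ofReal_div]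
  left; ring

noncomputable def bd (t r x : ℝ) : ℝ :=
  (x + π) * (Real.exp (π ^ 2 / (2 * t)) * Real.exp (-(1 / (2 * t)) * x ^ 2)) *
        (|x - r| * (r / 2)) ^ (-1 / 2 : ℝ)

lemma abs_int (r : ℝ) (hr : 0 < r) :
    IntervalIntegrable (fun x : ℝ => (|x - r| * (r / 2)) ^ (-1 / 2 : ℝ)) volume 0 (r + 1) := by
  have h0 : ∀ c : ℝ, IntervalIntegrable (fun x : ℝ => x ^ (-1 / 2 : ℝ)) volume 0 c := fun c =>
    intervalIntegral.intervalIntegrable_rpow' (by norm_num)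
  have h1 : IntervalIntegrable (fun x : ℝ => (|x - r|) ^ (-1 / 2 : ℝ)) volume 0 (r + 1) := by
    apply IntervalIntegrable.trans (b := r)
    · have := (h0 r).comp_sub_left r
      simp only [sub_zero, sub_self] at this
      refine this.symm.congr ?_
      intro x hx
      rw [Set.uIoc_of_le hr.le] at hx
      simp only
      rw [abs_sub_comm, abs_of_nonneg (by linarith [hx.2])]
    · have := (h0 1).comp_sub_right r
      simp only [zero_add] at this
      rw [add_comm 1 r] at this
      refine this.congr ?_
      intro x hx
      rw [Set.uIoc_of_le (by linarith)] at hx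
      simp only
      rw [abs_of_nonneg (by linarith [hx.1])]
  have := h1.mul_const ((r / 2) ^ (-1 / 2 : ℝ))
  refine this.congr ?_
  intro x hx
  simp only
  rw [Real.mul_rpow (abs_nonneg _) (by positivity)]

lemma gauss_int (t : ℝ) (ht : 0 < t) (A B : ℝ) :
    Integrable (fun x : ℝ => (x + A) * (B * Real.exp (-(1 / (2 * t)) * x ^ 2))) := by
  have hc : 0 < 1 / (2 * t) := by positivity
  have h1 := (integrable_mul_exp_neg_mul_sq hc).const_mul B
  have h2 := (integrable_exp_neg_mul_sq hc).const_mul (A * B)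
  refine (h1.add h2).congr (Filter.Eventually.of_forall fun x => ?_)
  simp only [Pi.add_apply]
  ring

lemma gauss_lim (t : ℝ) (ht : 0 < t) (A B : ℝ) :
    Tendsto (fun x : ℝ => (x + A) * (B * Real.exp (-(1 / (2 * t)) * x ^ 2))) atTop (𝓝 0) := by
  have hc : 0 < 1 / (2 * t) := by positivity
  have h1 := (tendsto_rpow_abs_mul_exp_neg_mul_sq_cocompact hc 1).mono_left atTop_le_cocompact
  have h2 := (tendsto_rpow_abs_mul_exp_neg_mul_sq_cocompact hc 0).mono_left atTop_le_cocompact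
  have h3 := (h1.const_mul B).add (h2.const_mul (A * B))
  simp only [mul_zero, add_zero] at h3
  refine h3.congr' ?_
  filter_upwards [eventually_ge_atTop 0] with x hx
  simp only [Real.rpow_one, Real.rpow_zero, abs_of_nonneg hx]
  ring

lemma bd_nonneg (t r x : ℝ) (hr : 0 < r) (hx : 0 ≤ x) : 0 ≤ bd t r x := by
  have := Real.pi_pos
  unfold bd
  positivity

lemma bd_le (t r x : ℝ) (hr : 0 < r) (hx : r + 1 ≤ x) : bd t r x ≤
    (x + π) * (Real.exp (π ^ 2 / (2 * t)) * (r / 2) ^ (-1 / 2 : ℝ) * Real.exp (-(1 / (2 * t)) * x ^ 2)) := by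
  have := Real.pi_pos
  unfold bd
  have h : (|x - r| * (r / 2)) ^ (-1 / 2 : ℝ) ≤ (r / 2) ^ (-1 / 2 : ℝ) := by
    apply Real.rpow_le_rpow_of_nonpos (by positivity) _ (by norm_num)
    rw [abs_of_nonneg (by linarith)]
    nlinarith
  have hx0 : 0 ≤ x := by linarith
  calc _ ≤ (x + π) * (Real.exp (π ^ 2 / (2 * t)) * Real.exp (-(1 / (2 * t)) * x ^ 2)) * (r / 2) ^ (-1 / 2 : ℝ) := by
        gcongr
    _ = _ := by ring

lemma bd_int (t r : ℝ) (ht : 0 < t) (hr : 0 < r) : IntegrableOn (bd t r) (Set.Ioi 0) := by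
  rw [← Set.Ioc_union_Ioi_eq_Ioi (by linarith : (0 : ℝ) ≤ r + 1)]
  apply IntegrableOn.union
  · rw [← intervalIntegrable_iff_integrableOn_Ioc_of_le (by linarith)]
    apply (abs_int r hr).continuousOn_mul
    fun_prop
  · refine Integrable.mono' (gauss_int t ht π (Real.exp (π ^ 2 / (2 * t)) * (r / 2) ^ (-1 / 2 : ℝ))).integrableOn ?_ ?_
    · apply Measurable.aestronglyMeasurable
      unfold bd
      fun_prop
    · rw [ae_restrict_iff' measurableSet_Ioi]
      refine Eventually.of_forall fun x hx => ?_
      have hx' : r + 1 < x := hx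
      rw [Real.norm_of_nonneg (bd_nonneg t r x hr (by linarith))]
      exact bd_le t r x hr hx'.le

lemma bd_lim (t r : ℝ) (ht : 0 < t) (hr : 0 < r) : Tendsto (bd t r) atTop (𝓝 0) := by
  refine tendsto_of_tendsto_of_tendsto_of_le_of_le' tendsto_const_nhds
    (gauss_lim t ht π (Real.exp (π ^ 2 / (2 * t)) * (r / 2) ^ (-1 / 2 : ℝ))) ?_ ?_
  · filter_upwards [eventually_ge_atTop 0] with x hx using bd_nonneg t r x hr hx
  · filter_upwards [eventually_ge_atTop (r + 1)] with x hx using bd_le t r x hr hx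

lemma ae_ne (r : ℝ) : ∀ᵐ x : ℝ, x ≠ r := by
  simp [ae_iff, measure_singleton]

lemma fK_int (t r y : ℝ) (ht : 0 < t) (hr : 0 < r) (hy : 0 ≤ y) (hy' : y ≤ π) :
    IntegrableOn (fun x : ℝ => fK t r (x + y * Complex.I)) (Set.Ioi 0) := by
  refine Integrable.mono' (bd_int t r ht hr) ?_ ?_
  · exact ((fK_meas t r).comp (by fun_prop)).aestronglyMeasurable
  · rw [ae_restrict_iff' measurableSet_Ioi]
    filter_upwards [ae_ne r] with x hx hx0
    exact fK_bound t r x y ht hr (le_of_lt hx0) hx hy hy'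

lemma fK_vert (t r R : ℝ) (hr : 0 < r) (hR : 0 ≤ R) (hRr : R ≠ r) :
    ContinuousOn (fun y : ℝ => fK t r (R + y * Complex.I)) (Set.Icc 0 π) := by
  intro y hy
  have h := (fK_diff t r R y hr hR hy.1 hy.2 (by tauto)).continuousAt
  apply ContinuousAt.continuousWithinAt
  exact ContinuousAt.comp (f := fun y : ℝ => (R + y * Complex.I : ℂ)) h (by fun_prop)

lemma cauchy_eps (t r R e : ℝ) (hr : 0 < r) (hR : 0 ≤ R) (he : e ∈ Set.Ioo 0 π) :
    (∫ x in (0 : ℝ)..R, fK t r (x + e * Complex.I)) - (∫ x in (0 : ℝ)..R, fK t r (x + (π : ℝ) * Complex.I)) +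
      Complex.I • (∫ y in e..π, fK t r (R + y * Complex.I)) -
      Complex.I • (∫ y in e..π, fK t r ((0 : ℝ) + y * Complex.I)) = 0 := by
  have := Complex.integral_boundary_rect_eq_zero_of_differentiableOn (fK t r) ⟨0, e⟩ ⟨R, π⟩ ?_
  · simpa using this
  · intro z hz
    rw [Complex.mem_reProdIm] at hz
    simp only [Set.uIcc_of_le hR, Set.uIcc_of_le he.2.le] at hz
    rw [← Complex.re_add_im z]
    apply (fK_diff t r z.re z.im hr hz.1.1 (he.1.le.trans hz.2.1) hz.2.2 _).differentiableWithinAt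
    rintro ⟨_, h⟩
    have := hz.2.1
    have := he.1
    linarith

lemma vert_lim (t r R : ℝ) (hr : 0 < r) (hR : 0 ≤ R) (hRr : R ≠ r) :
    Tendsto (fun e : ℝ => ∫ y in e..π, fK t r (R + y * Complex.I)) (𝓝[Set.Ioo 0 π] 0)
      (𝓝 (∫ y in (0 : ℝ)..π, fK t r (R + y * Complex.I))) := by
  have h := (fK_vert t r R hr hR hRr)
  rw [← Set.uIcc_of_le Real.pi_pos.le] at h
  have h2 := intervalIntegral.continuousOn_primitive_interval_left
    (h.integrableOn_compact (μ := volume) isCompact_uIcc) 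
  have h3 := h2 0 (by simp)
  rw [Set.uIcc_of_le Real.pi_pos.le] at h3
  exact h3.mono_left (nhdsWithin_mono _ Set.Ioo_subset_Icc_self)

lemma bot_lim (t r R : ℝ) (ht : 0 < t) (hr : 0 < r) (hR : 0 ≤ R) :
    Tendsto (fun e : ℝ => ∫ x in (0 : ℝ)..R, fK t r (x + e * Complex.I)) (𝓝[Set.Ioo 0 π] 0)
      (𝓝 (∫ x in (0 : ℝ)..R, fK t r x)) := by
  apply intervalIntegral.tendsto_integral_filter_of_dominated_convergence (bd t r)
  · refine Eventually.of_forall fun e => ?_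
    exact ((fK_meas t r).comp (by fun_prop)).aestronglyMeasurable
  · filter_upwards [self_mem_nhdsWithin] with e he
    filter_upwards [ae_ne r] with x hx hx0
    rw [Set.uIoc_of_le hR] at hx0
    exact fK_bound t r x e ht hr hx0.1.le hx he.1.le he.2.le
  · rw [intervalIntegrable_iff_integrableOn_Ioc_of_le hR]
    exact (bd_int t r ht hr).mono_set Set.Ioc_subset_Ioi_self
  · filter_upwards [ae_ne r] with x hx hx0
    rw [Set.uIoc_of_le hR] at hx0
    have h := (fK_diff t r x 0 hr hx0.1.le le_rfl Real.pi_pos.le (by tauto)).continuousAt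
    have h2 : ContinuousAt (fun e : ℝ => fK t r (x + e * Complex.I)) 0 :=
      ContinuousAt.comp (f := fun y : ℝ => (x + y * Complex.I : ℂ)) h (by fun_prop)
    have h3 := h2.tendsto
    simp only [Complex.ofReal_zero, zero_mul, add_zero] at h3
    exact h3.mono_left nhdsWithin_le_nhds

lemma cauchy_zero (t r R : ℝ) (ht : 0 < t) (hr : 0 < r) (hR : r < R) :
    (∫ x in (0 : ℝ)..R, fK t r x) - (∫ x in (0 : ℝ)..R, fK t r (x + (π : ℝ) * Complex.I)) +
      Complex.I • (∫ y in (0 : ℝ)..π, fK t r (R + y * Complex.I)) -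
      Complex.I • (∫ y in (0 : ℝ)..π, fK t r ((0 : ℝ) + y * Complex.I)) = 0 := by
  have hR0 : 0 ≤ R := by linarith
  have : (𝓝[Set.Ioo 0 π] (0 : ℝ)).NeBot := by
    rw [nhdsWithin_Ioo_eq_nhdsGT Real.pi_pos]; infer_instance
  have h := (((bot_lim t r R ht hr hR0).sub_const (∫ x in (0 : ℝ)..R, fK t r (x + (π : ℝ) * Complex.I))).add
    ((vert_lim t r R hr hR0 hR.ne').const_smul Complex.I)).sub
    ((vert_lim t r 0 hr le_rfl hr.ne).const_smul Complex.I)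
  refine tendsto_nhds_unique h ?_
  refine tendsto_const_nhds.congr' ?_
  filter_upwards [self_mem_nhdsWithin] with e he
  exact (cauchy_eps t r R e hr hR0 he).symm

lemma bot_im (t r R : ℝ) (ht : 0 < t) (hr : 0 < r) (hR : r < R) :
    (∫ x in (0 : ℝ)..R, fK t r x).im = ∫ x in r..R, mI t r x := by
  have hint : IntegrableOn (fun x : ℝ => fK t r x) (Set.Ioi 0) := by
    simpa using fK_int t r 0 ht hr le_rfl Real.pi_pos.le
  rw [← intervalIntegral.integral_add_adjacent_intervals (b := r)]
  · have h1 : (∫ x in (0 : ℝ)..r, fK t r x) = ∫ x in (0 : ℝ)..r,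
        ((x * Real.exp (-x ^ 2 / (2 * t)) * (Real.cosh r - Real.cosh x) ^ (-1 / 2 : ℝ) : ℝ) : ℂ) := by
      apply intervalIntegral.integral_congr
      intro x hx
      rw [Set.uIcc_of_le hr.le] at hx
      exact fK_bottom_lt t r x (Real.cosh_le_cosh.2 (by
        rw [abs_of_nonneg hx.1, abs_of_pos hr]; exact hx.2))
    have h2 : (∫ x in r..R, fK t r x) = ∫ x in r..R, Complex.I * ((mI t r x : ℝ) : ℂ) := by
      apply intervalIntegral.integral_congr
      intro x hx
      rw [Set.uIcc_of_le hR.le] at hx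
      exact fK_bottom_gt t r x (Real.cosh_le_cosh.2 (by
        rw [abs_of_nonneg (hr.le.trans hx.1), abs_of_pos hr]; exact hx.1))
    rw [h1, h2, intervalIntegral.integral_const_mul, intervalIntegral.integral_ofReal,
      intervalIntegral.integral_ofReal]
    simp
  · rw [intervalIntegrable_iff_integrableOn_Ioc_of_le hr.le]
    exact hint.mono_set Set.Ioc_subset_Ioi_self
  · rw [intervalIntegrable_iff_integrableOn_Ioc_of_le hR.le]
    exact hint.mono_set (fun x hx => hr.trans hx.1)

lemma left_im (t r : ℝ) :
    (Complex.I • (∫ y in (0 : ℝ)..π, fK t r ((0 : ℝ) + y * Complex.I))).im = 0 := by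
  simp only [Complex.ofReal_zero, zero_add, fK_left]
  rw [intervalIntegral.integral_const_mul, intervalIntegral.integral_ofReal]
  simp

lemma top_im (t r R : ℝ) (ht : 0 < t) (hr : 0 < r) (hR : 0 ≤ R) :
    (∫ x in (0 : ℝ)..R, fK t r (x + (π : ℝ) * Complex.I)).im = ∫ x in (0 : ℝ)..R, qI t r x := by
  have hint := (fK_int t r π ht hr Real.pi_pos.le le_rfl).mono_set
    (Set.Ioc_subset_Ioi_self : Set.Ioc 0 R ⊆ _)
  simp only [← fK_top t r _ ht]
  rw [intervalIntegral.integral_of_le hR, intervalIntegral.integral_of_le hR]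
  exact (integral_im hint).symm

lemma mI_int (t r : ℝ) (ht : 0 < t) (hr : 0 < r) : IntegrableOn (mI t r) (Set.Ioi r) := by
  have hint : IntegrableOn (fun x : ℝ => fK t r x) (Set.Ioi 0) := by
    simpa using fK_int t r 0 ht hr le_rfl Real.pi_pos.le
  have h := (hint.mono_set (Set.Ioi_subset_Ioi hr.le)).im
  refine IntegrableOn.congr_fun h ?_ measurableSet_Ioi
  intro x hx
  have hx' : r < x := hx
  simp only
  rw [fK_bottom_gt t r x (Real.cosh_le_cosh.2 (by
        rw [abs_of_nonneg (hr.le.trans hx'.le), abs_of_pos hr]; exact hx'.le))]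
  simp

lemma qI_int (t r : ℝ) (ht : 0 < t) (hr : 0 < r) : IntegrableOn (qI t r) (Set.Ioi 0) := by
  have h := (fK_int t r π ht hr Real.pi_pos.le le_rfl).im
  refine IntegrableOn.congr_fun h ?_ measurableSet_Ioi
  intro x hx
  exact fK_top t r x ht

lemma right_lim (t r : ℝ) (ht : 0 < t) (hr : 0 < r) :
    Tendsto (fun R : ℝ => (Complex.I • ∫ y in (0 : ℝ)..π, fK t r (R + y * Complex.I)).im) atTop (𝓝 0) := by
  have h := (bd_lim t r ht hr).mul_const |π - 0|
  rw [zero_mul] at h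
  refine squeeze_zero_norm' ?_ h
  filter_upwards [eventually_gt_atTop r] with R hR
  refine (Complex.abs_im_le_norm _).trans ?_
  rw [norm_smul, Complex.norm_I, one_mul]
  apply intervalIntegral.norm_integral_le_of_norm_le_const
  intro y hy
  rw [Set.uIoc_of_le Real.pi_pos.le] at hy
  exact fK_bound t r R y ht hr (by linarith) hR.ne' hy.1.le hy.2

lemma main_eq (t r : ℝ) (ht : 0 < t) (hr : 0 < r) :
    ∫ x in Set.Ioi r, mI t r x = ∫ x in Set.Ioi 0, qI t r x := by
  have h1 := intervalIntegral_tendsto_integral_Ioi r (mI_int t r ht hr) tendsto_id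
  have h2 := (intervalIntegral_tendsto_integral_Ioi 0 (qI_int t r ht hr) tendsto_id).sub (right_lim t r ht hr)
  rw [sub_zero] at h2
  refine tendsto_nhds_unique h1 (h2.congr' ?_)
  filter_upwards [eventually_gt_atTop r] with R hR
  have h := congrArg Complex.im (cauchy_zero t r R ht hr hR)
  rw [Complex.sub_im, Complex.add_im, Complex.sub_im, left_im, bot_im t r R ht hr hR,
    top_im t r R ht hr (by linarith), Complex.zero_im] at h
  simp only [id]
  linarith

noncomputable def gI (t r b : ℝ) : ℝ :=
  Real.exp ((π ^ 2 - b ^ 2) / (2 * t)) * Real.sinh b * Real.sin (π * b / t) /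
        (Real.cosh b + Real.cosh r) ^ ((3 : ℝ) / 2)

lemma exp_split (t b : ℝ) : Real.exp ((π ^ 2 - b ^ 2) / (2 * t)) =
    Real.exp (π ^ 2 / (2 * t)) * Real.exp (-(1 / (2 * t)) * b ^ 2) := by
  rw [← Real.exp_add]; congr 1; ring

lemma gI_int (t r : ℝ) (ht : 0 < t) : IntegrableOn (gI t r) (Set.Ioi 0) := by
  have hc : 0 < 1 / (2 * t) := by positivity
  refine Integrable.mono' ((integrable_exp_neg_mul_sq hc).const_mul (Real.exp (π ^ 2 / (2 * t)))).integrableOn ?_ ?_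
  · apply Measurable.aestronglyMeasurable
    unfold gI
    fun_prop
  · rw [ae_restrict_iff' measurableSet_Ioi]
    refine Eventually.of_forall fun x hx => ?_
    have hx' : 0 < x := hx
    unfold gI
    have h1 := Real.one_le_cosh x
    have h2 := Real.cosh_pos r
    have h3 : Real.sinh x ≤ Real.cosh x := (Real.sinh_lt_cosh x).le
    have h0 : 0 < Real.sinh x := Real.sinh_pos_iff.2 hx'
    have h4 : Real.cosh x + Real.cosh r ≤ (Real.cosh x + Real.cosh r) ^ ((3 : ℝ) / 2) :=
      Real.self_le_rpow_of_one_le (by linarith) (by norm_num)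
    rw [norm_div, norm_mul, norm_mul, Real.norm_of_nonneg (Real.exp_pos _).le, Real.norm_of_nonneg h0.le,
      Real.norm_of_nonneg (by positivity : 0 ≤ (Real.cosh x + Real.cosh r) ^ ((3 : ℝ) / 2)), Real.norm_eq_abs,
      ← exp_split, div_le_iff₀ (by positivity), mul_assoc]
    have h5 := Real.abs_sin_le_one (π * x / t)
    gcongr
    calc _ ≤ Real.sinh x * 1 := by gcongr
      _ ≤ _ := by linarith

lemma parts_eq (t r : ℝ) (ht : 0 < t) (hr : 0 < r) :
    ∫ x in Set.Ioi 0, (qI t r x / t - 1 / 2 * gI t r x) = 0 := by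
  have key := integral_Ioi_of_hasDerivAt_of_tendsto' (a := 0) (m := 0)
    (f := fun b => Real.exp ((π ^ 2 - b ^ 2) / (2 * t)) * Real.sin (π * b / t) *
      (Real.cosh b + Real.cosh r) ^ (-(1 : ℝ) / 2))
    (f' := fun x => qI t r x / t - 1 / 2 * gI t r x) ?_ ?_ ?_
  · rw [key]; simp
  · intro x _
    have h1 : HasDerivAt (fun b : ℝ => Real.exp ((π ^ 2 - b ^ 2) / (2 * t)))
        (Real.exp ((π ^ 2 - x ^ 2) / (2 * t)) * (-(2 * x) / (2 * t))) x := by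
      have := (((hasDerivAt_pow 2 x).const_sub (π ^ 2)).div_const (2 * t)).exp
      simpa using this
    have h2 : HasDerivAt (fun b : ℝ => Real.sin (π * b / t)) (Real.cos (π * x / t) * (π / t)) x := by
      have := (((hasDerivAt_id x).const_mul π).div_const t).sin
      simpa using this
    have hp : 0 < Real.cosh x + Real.cosh r := by
      have := Real.cosh_pos x
      have := Real.cosh_pos r
      positivity
    have h3 := ((Real.hasDerivAt_cosh x).add_const (Real.cosh r)).rpow_const (p := -(1 : ℝ) / 2) (Or.inl hp.ne')
    refine ((h1.mul h2).mul h3).congr_deriv ?_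
    unfold qI gI
    have h4 : (-(1 : ℝ) / 2 - 1) = -(3 / 2) := by norm_num
    rw [h4, Real.rpow_neg hp.le]
    simp only [Pi.mul_apply]
    field_simp
    ring
  · exact ((qI_int t r ht hr).div_const t).sub ((gI_int t r ht).const_mul _)
  · have hc : 0 < 1 / (2 * t) := by positivity
    have h2 := (tendsto_rpow_abs_mul_exp_neg_mul_sq_cocompact hc 0).mono_left atTop_le_cocompact
    have h3 := h2.const_mul (Real.exp (π ^ 2 / (2 * t)))
    rw [mul_zero] at h3
    refine squeeze_zero_norm (fun x => ?_) h3
    have h1 := Real.one_le_cosh x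
    have h2 := Real.cosh_pos r
    rw [norm_mul, norm_mul, Real.norm_of_nonneg (Real.exp_pos _).le, Real.rpow_zero, one_mul, ← exp_split,
      Real.norm_of_nonneg (by positivity : 0 ≤ (Real.cosh x + Real.cosh r) ^ (-(1 : ℝ) / 2)), Real.norm_eq_abs]
    have h5 := Real.abs_sin_le_one (π * x / t)
    have h6 : (Real.cosh x + Real.cosh r) ^ (-(1 : ℝ) / 2) ≤ 1 :=
      Real.rpow_le_one_of_one_le_of_nonpos (by linarith) (by norm_num)
    calc _ ≤ Real.exp ((π ^ 2 - x ^ 2) / (2 * t)) * 1 * 1 := by gcongr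
      _ = _ := by ring

lemma parts_eq' (t r : ℝ) (ht : 0 < t) (hr : 0 < r) :
    ∫ x in Set.Ioi 0, qI t r x = t / 2 * ∫ x in Set.Ioi 0, gI t r x := by
  have h := parts_eq t r ht hr
  rw [integral_sub ((qI_int t r ht hr).div_const t) ((gI_int t r ht).const_mul _), integral_div,
    integral_const_mul] at h
  field_simp at h ⊢
  linarith

/-- For every `t > 0` and `r > 0`, the McKean kernel coincides with the Gruet kernel in
dimension 2. -/
theorem mckean_eq_gruet_two (t r : ℝ) (ht : 0 < t) (hr : 0 < r) :
    mckean t r = gruet 2 t r := by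
  have hm : mckean t r = Real.sqrt 2 * Real.exp (-t / 8) / (2 * π * t) ^ ((3 : ℝ) / 2) *
      ∫ b in Set.Ioi r, mI t r b := rfl
  have hg : gruet 2 t r = Real.exp (-t / 8) / (π * (2 * π) * Real.sqrt t) * (Real.sqrt π / 2) *
      ∫ b in Set.Ioi (0 : ℝ), gI t r b := by
    unfold gruet gI
    have e1 : -(((2 : ℕ) : ℝ) - 1) ^ 2 * t / 8 = -t / 8 := by push_cast; ring
    have e2 : (((2 : ℕ) : ℝ) + 1) / 2 = 3 / 2 := by push_cast; norm_num
    have e3 : ((2 : ℕ) : ℝ) / 2 = 1 := by push_cast; norm_num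
    have e4 : Real.Gamma (3 / 2) = Real.sqrt π / 2 := by
      rw [show (3 / 2 : ℝ) = 1 / 2 + 1 by norm_num, Real.Gamma_add_one (by norm_num),
        Real.Gamma_one_half_eq]
      ring
    rw [e1, e2, e3, e4, Real.rpow_one]
  have hpi := Real.pi_pos
  have h32 : (2 * π * t) ^ ((3 : ℝ) / 2) = 2 * π * t * (Real.sqrt 2 * Real.sqrt π * Real.sqrt t) := by
    rw [show (3 / 2 : ℝ) = 1 + 1 / 2 by norm_num, Real.rpow_add (by positivity), Real.rpow_one,
      ← Real.sqrt_eq_rpow, Real.sqrt_mul (by positivity), Real.sqrt_mul (by positivity)]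
  rw [hm, hg, main_eq t r ht hr, parts_eq' t r ht hr, h32]
  have s1 : Real.sqrt π * Real.sqrt π = π := Real.mul_self_sqrt hpi.le
  have s2 : 0 < Real.sqrt π := Real.sqrt_pos.2 hpi
  have s3 : 0 < Real.sqrt t := Real.sqrt_pos.2 ht
  have s4 : 0 < Real.sqrt 2 := Real.sqrt_pos.2 (by norm_num)
  have hco : Real.sqrt 2 * Real.exp (-t / 8) / (2 * π * t * (Real.sqrt 2 * Real.sqrt π * Real.sqrt t)) * (t / 2) =
      Real.exp (-t / 8) / (π * (2 * π) * Real.sqrt t) * (Real.sqrt π / 2) := by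
    rw [div_mul_div_comm, div_mul_div_comm, div_eq_div_iff (by positivity) (by positivity)]
    linear_combination (-4 * Real.sqrt 2 * Real.exp (-t / 8) * t * π * Real.sqrt t) * s1
  rw [← hco]
  ring
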